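/- arXiv:math/0608336 — 2 statements merged into one kernel-verified Lean document; each statement's English description precedes it below -/
import Mathlib

section
/- Let B be a Boolean algebra admitting a decomposition B \ {0} = ⋃_{n<ω} B_n with (i) B_n ⊆ B_{n+1}, (ii) int(B_n) ≥ 2^{-n}, and (iii) every a ∈ B_n contains two disjoint nonzero elements of B_{n+1}. Then B carries a strictly positive nonatomic finitely additive measure. -/
open scoped symmDiff

/-- The intersection number of a family `A` of elements of a Boolean algebra:
the supremum of `r ∈ [0,1]` such that every finite sequence from `A` (with repetitions)
has a subsequence of proportion at least `r` with nonzero meet. -/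
noncomputable def interNum {α : Type*} [BooleanAlgebra α] (A : Set α) : ℝ :=
  sSup {r : ℝ | 0 ≤ r ∧ r ≤ 1 ∧ ∀ (m : ℕ) (f : Fin m → α), (∀ i, f i ∈ A) →
    ∃ s : Finset (Fin m), r * (m : ℝ) ≤ (s.card : ℝ) ∧ (s.Nonempty → s.inf f ≠ ⊥)}

/-- A finitely additive (nonnegative, finite) measure on a Boolean algebra. -/
def IsFAMeasure {α : Type*} [BooleanAlgebra α] (μ : α → ℝ) : Prop :=
  μ ⊥ = 0 ∧ (∀ a, 0 ≤ μ a) ∧ ∀ a b : α, a ⊓ b = ⊥ → μ (a ⊔ b) = μ a + μ b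

/-- A finitely additive probability measure on a Boolean algebra. -/
def IsFAProb {α : Type*} [BooleanAlgebra α] (μ : α → ℝ) : Prop :=
  IsFAMeasure μ ∧ μ ⊤ = 1

/-- `μ` is strictly positive. -/
def StrictlyPositive {α : Type*} [BooleanAlgebra α] (μ : α → ℝ) : Prop :=
  ∀ a : α, a ≠ ⊥ → 0 < μ a

/-- `μ` is nonatomic: for every `ε > 0` there is a finite partition of `⊤`
into elements of measure `< ε`. -/
def Nonatomic {α : Type*} [BooleanAlgebra α] (μ : α → ℝ) : Prop :=
  ∀ ε : ℝ, 0 < ε → ∃ s : Finset α,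
    (↑s : Set α).PairwiseDisjoint id ∧ s.sup id = ⊤ ∧ ∀ a ∈ s, μ a < ε

section FiniteAdditivity

variable {α : Type*} [BooleanAlgebra α]

lemma IsFAMeasure.mono {μ : α → ℝ} (hμ : IsFAMeasure μ) {a b : α} (h : a ≤ b) : μ a ≤ μ b := by
  have h1 := hμ.2.2 a (b \ a) inf_sdiff_self_right
  rw [sup_sdiff_cancel_right h] at h1
  linarith [hμ.2.1 (b \ a)]

/-- Subprobability measures form a compact set for pointwise convergence. -/
lemma isCompact_setOf_isFAMeasure :
    IsCompact {μ : α → ℝ | IsFAMeasure μ ∧ μ ⊤ ≤ 1} := by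
  refine (isCompact_univ_pi (fun _ : α => isCompact_Icc (a := (0 : ℝ)) (b := 1))).of_isClosed_subset
    ?_ ?_
  · have hc : ∀ a : α, Continuous fun μ : α → ℝ => μ a := fun a => continuous_apply a
    simp only [IsFAMeasure, Set.ofPred_and, Set.ofPred_forall]
    refine ((isClosed_eq (hc _) continuous_const).inter
      ((isClosed_iInter fun a => isClosed_le continuous_const (hc a)).inter
        (isClosed_iInter fun a => isClosed_iInter fun b => isClosed_iInter fun _ =>
          isClosed_eq (hc _) ((hc a).add (hc b))))).inter (isClosed_le (hc _) continuous_const)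
  · rintro μ ⟨hμ, h1⟩ a -
    exact ⟨hμ.2.1 a, (hμ.mono le_top).trans h1⟩

lemma convex_setOf_isFAMeasure :
    Convex ℝ {μ : α → ℝ | IsFAMeasure μ ∧ μ ⊤ ≤ 1} := by
  rintro μ ⟨⟨h0, hn, ha⟩, h1⟩ ν ⟨⟨k0, kn, ka⟩, k1⟩ s t hs ht hst
  refine ⟨⟨?_, ?_, ?_⟩, ?_⟩
  · simp [h0, k0]
  · intro a
    have := mul_nonneg hs (hn a)
    have := mul_nonneg ht (kn a)
    simp only [Pi.add_apply, Pi.smul_apply, smul_eq_mul]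
    linarith
  · intro a b hab
    simp only [Pi.add_apply, Pi.smul_apply, smul_eq_mul, ha a b hab, ka a b hab]
    ring
  · simp only [Pi.add_apply, Pi.smul_apply, smul_eq_mul]
    nlinarith

open Classical in
/-- The two-valued measure that vanishes exactly on the ideal `I`. -/
noncomputable def diracOf (I : Order.Ideal α) (a : α) : ℝ := if a ∈ I then 0 else 1

lemma diracOf_nonneg (I : Order.Ideal α) (a : α) : 0 ≤ diracOf I a := by
  unfold diracOf; split_ifs <;> norm_num

lemma diracOf_le_one (I : Order.Ideal α) (a : α) : diracOf I a ≤ 1 := by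
  unfold diracOf; split_ifs <;> norm_num

lemma isFAMeasure_diracOf {I : Order.Ideal α} (hI : I.IsPrime) : IsFAMeasure (diracOf I) := by
  refine ⟨by simp [diracOf], diracOf_nonneg I, fun a b hab => ?_⟩
  have h : a ∈ I ∨ b ∈ I := hI.mem_or_mem (by rw [hab]; exact I.bot_mem)
  have hs : a ⊔ b ∈ I ↔ a ∈ I ∧ b ∈ I := Order.Ideal.sup_mem_iff
  unfold diracOf
  by_cases ha : a ∈ I <;> by_cases hb : b ∈ I <;> simp_all

lemma exists_isPrime_ge {J : Order.Ideal α} (hJ : ⊤ ∉ J) :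
    ∃ I : Order.Ideal α, I.IsPrime ∧ J ≤ I := by
  have hd : Disjoint ((Order.PFilter.principal (⊤ : α) : Order.PFilter α) : Set α) (J : Set α) := by
    rw [Set.disjoint_left]
    intro x hx hxJ
    have : x = ⊤ := top_le_iff.1 (Order.PFilter.mem_principal.1 hx)
    exact hJ (this ▸ hxJ)
  obtain ⟨I, hI, hJI, -⟩ := DistribLattice.prime_ideal_of_disjoint_filter_ideal hd
  exact ⟨I, hI, hJI⟩

lemma exists_isPrime_notMem {a : α} (ha : a ≠ ⊥) :
    ∃ I : Order.Ideal α, I.IsPrime ∧ a ∉ I := by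
  obtain ⟨I, hI, hle⟩ := exists_isPrime_ge (J := Order.Ideal.principal aᶜ)
    (fun h => ha (by simpa using h))
  refine ⟨I, hI, fun haI => ?_⟩
  have hc : aᶜ ∈ I := hle (Order.Ideal.mem_principal.2 le_rfl)
  have : (⊤ : α) ∈ I := by
    rw [← sup_compl_eq_top (x := a)]
    exact Order.Ideal.sup_mem haI hc
  exact hI.toIsProper.top_notMem this

lemma exists_interNum_mul_le_card [Nontrivial α] (A : Set α) (m : ℕ) (f : Fin m → α)
    (hf : ∀ i, f i ∈ A) :
    ∃ s : Finset (Fin m), interNum A * m ≤ s.card ∧ s.inf f ≠ ⊥ := by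
  classical
  obtain ⟨s, hs, hmax⟩ := Finset.exists_max_image
    (Finset.univ.filter fun s : Finset (Fin m) => s.inf f ≠ ⊥) Finset.card ⟨∅, by simp⟩
  refine ⟨s, ?_, (Finset.mem_filter.1 hs).2⟩
  rcases Nat.eq_zero_or_pos m with rfl | hm
  · simp
  have hm' : (0 : ℝ) < m := by exact_mod_cast hm
  rw [← le_div_iff₀ hm']
  refine Real.sSup_le ?_ (by positivity)
  rintro r ⟨-, -, hr⟩
  obtain ⟨t, ht, hne⟩ := hr m f hf
  rw [le_div_iff₀ hm']
  have ht' : t.inf f ≠ ⊥ := by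
    rcases t.eq_empty_or_nonempty with rfl | h
    · simp
    · exact hne h
  exact ht.trans (by exact_mod_cast hmax t (by simp [ht']))

/-- Multiplicities `n` on a finite part of `A` yield a two-valued measure carrying at least the
proportion `interNum A` of the total multiplicity. -/
lemma exists_isPrime_interNum_mul_sum_le [Nontrivial α] {A : Set α} {F : Finset α}
    (hF : ∀ a ∈ F, a ∈ A) (n : F → ℕ) :
    ∃ I : Order.Ideal α, I.IsPrime ∧
      interNum A * ∑ a, (n a : ℝ) ≤ ∑ a : F, n a * diracOf I a := by
  classical
  let e := Fintype.equivFin (Σ a : F, Fin (n a))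
  obtain ⟨s, hs, hne⟩ := exists_interNum_mul_le_card A _ (fun i => ((e.symm i).1 : α))
    (fun i => hF _ (e.symm i).1.2)
  obtain ⟨I, hI, hnot⟩ := exists_isPrime_notMem hne
  refine ⟨I, hI, ?_⟩
  have hmem : ∀ i ∈ s, diracOf I ((e.symm i).1 : α) = 1 := by
    intro i hi
    have : ((e.symm i).1 : α) ∉ I := fun h => hnot (I.lower (Finset.inf_le hi) h)
    simp [diracOf, this]
  have h1 : (s.card : ℝ) ≤ ∑ i, diracOf I ((e.symm i).1 : α) := by
    calc (s.card : ℝ) = ∑ i ∈ s, diracOf I ((e.symm i).1 : α) := by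
          rw [Finset.sum_congr rfl hmem]; simp
      _ ≤ _ := Finset.sum_le_sum_of_subset_of_nonneg (Finset.subset_univ s)
          fun i _ _ => diracOf_nonneg I _
  have h2 : ∑ i, diracOf I ((e.symm i).1 : α) = ∑ a : F, n a * diracOf I a := by
    rw [Equiv.sum_comp e.symm (fun x : Σ a : F, Fin (n a) => diracOf I (x.1 : α)),
      Fintype.sum_sigma]
    simp
  have h3 : (Fintype.card (Σ a : F, Fin (n a)) : ℝ) = ∑ a, (n a : ℝ) := by
    simp
  rw [← h3, ← h2]
  exact hs.trans h1

lemma exists_isFAMeasure_interNum_le_of_finset [Nontrivial α] {A : Set α} (hA : 0 ≤ interNum A)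
    {F : Finset α} (hF : ∀ a ∈ F, a ∈ A) :
    ∃ μ : α → ℝ, (IsFAMeasure μ ∧ μ ⊤ ≤ 1) ∧ ∀ a ∈ F, interNum A ≤ μ a := by
  classical
  by_contra! hcon
  let R : (α → ℝ) →ₗ[ℝ] (F → ℝ) := LinearMap.funLeft ℝ ℝ ((↑) : F → α)
  have hRc : Continuous R := continuous_pi fun a => continuous_apply (a : α)
  have hDclosed : IsClosed {v : F → ℝ | ∀ a, interNum A ≤ v a} := by
    simp only [Set.ofPred_forall]
    exact isClosed_iInter fun a => isClosed_le continuous_const (continuous_apply a)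
  have hDconv : Convex ℝ {v : F → ℝ | ∀ a, interNum A ≤ v a} := by
    intro x hx y hy s t hs ht hst a
    have h1 := mul_le_mul_of_nonneg_left (hx a) hs
    have h2 := mul_le_mul_of_nonneg_left (hy a) ht
    simp only [Pi.add_apply, Pi.smul_apply, smul_eq_mul]
    calc interNum A = s * interNum A + t * interNum A := by rw [← add_mul, hst, one_mul]
      _ ≤ _ := add_le_add h1 h2
  have hdisj : Disjoint (R '' {μ : α → ℝ | IsFAMeasure μ ∧ μ ⊤ ≤ 1})
      {v : F → ℝ | ∀ a, interNum A ≤ v a} := by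
    rw [Set.disjoint_left]
    rintro _ ⟨μ, hμ, rfl⟩ hv
    obtain ⟨a, ha, hlt⟩ := hcon μ hμ
    exact absurd (hv ⟨a, ha⟩) (not_le.2 hlt)
  obtain ⟨f, u, v, hfu, huv, hfv⟩ := geometric_hahn_banach_compact_closed
    (convex_setOf_isFAMeasure.linear_image R) (isCompact_setOf_isFAMeasure.image hRc)
    hDconv hDclosed hdisj
  let w : F → ℝ := fun a => f (Pi.single a 1)
  have hf : ∀ x : F → ℝ, f x = ∑ a, x a * w a := by
    intro x
    conv_lhs => rw [pi_eq_sum_univ' x]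
    simp only [map_sum, map_smul, smul_eq_mul, w]
  have hw : ∀ a, 0 ≤ w a := by
    intro a
    by_contra! hneg
    have hbase := hfv (fun _ => interNum A) (fun _ => le_rfl)
    let t : ℝ := (f (fun _ => interNum A) - v) / (-w a)
    have ht : 0 ≤ t := div_nonneg (by linarith) (by linarith)
    have h := hfv ((fun _ => interNum A) + t • Pi.single a 1) (by
      intro b
      have : 0 ≤ (Pi.single a (1 : ℝ) : F → ℝ) b := by
        by_cases hb : b = a
        · subst hb; simp
        · simp [hb]
      simp only [Pi.add_apply, Pi.smul_apply, smul_eq_mul]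
      linarith [mul_nonneg ht this])
    rw [map_add, map_smul, smul_eq_mul] at h
    have h2 : t * w a = -(f (fun _ => interNum A) - v) := by
      simp only [t]; field_simp [hneg.ne]
    change v < f (fun _ => interNum A) + t * w a at h
    linarith
  have hv : v < interNum A * ∑ a, w a := by
    have := hfv (fun _ => interNum A) (fun _ => le_rfl)
    rwa [hf, ← Finset.mul_sum] at this
  obtain ⟨N, hN⟩ := exists_nat_gt ((F.card : ℝ) / (v - u))
  rw [div_lt_iff₀ (by linarith)] at hN
  obtain ⟨I, hI, hle⟩ := exists_isPrime_interNum_mul_sum_le hF (fun a => ⌈N * w a⌉₊)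
  have hIu := hfu (R (diracOf I)) ⟨_, ⟨isFAMeasure_diracOf hI, diracOf_le_one I _⟩, rfl⟩
  rw [hf] at hIu
  have hN0 : (0 : ℝ) ≤ N := Nat.cast_nonneg N
  have hlow : N * v ≤ interNum A * ∑ a, (⌈N * w a⌉₊ : ℝ) := by
    calc N * v ≤ N * (interNum A * ∑ a, w a) := mul_le_mul_of_nonneg_left hv.le hN0
      _ = interNum A * ∑ a, N * w a := by rw [← Finset.mul_sum]; ring
      _ ≤ _ := mul_le_mul_of_nonneg_left (Finset.sum_le_sum fun a _ => Nat.le_ceil _) hA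
  have hup : ∑ a : F, (⌈N * w a⌉₊ : ℝ) * diracOf I a ≤ N * u + F.card := by
    calc ∑ a : F, (⌈N * w a⌉₊ : ℝ) * diracOf I a
        ≤ ∑ a : F, (N * (R (diracOf I) a * w a) + 1) := by
          refine Finset.sum_le_sum fun a _ => ?_
          have h1 := (Nat.ceil_lt_add_one (mul_nonneg hN0 (hw a))).le
          have h2 := mul_le_mul_of_nonneg_right h1 (diracOf_nonneg I (a : α))
          have h3 := diracOf_le_one I (a : α)
          change _ ≤ N * (diracOf I (a : α) * w a) + 1
          linarith
      _ = N * ∑ a : F, R (diracOf I) a * w a + F.card := by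
          rw [Finset.sum_add_distrib, Finset.mul_sum]; simp
      _ ≤ _ := by gcongr
  nlinarith

/-- The nontrivial direction of Kelley's theorem on intersection numbers. -/
lemma exists_isFAMeasure_interNum_le [Nontrivial α] {A : Set α} (hA : 0 ≤ interNum A) :
    ∃ μ : α → ℝ, (IsFAMeasure μ ∧ μ ⊤ ≤ 1) ∧ ∀ a ∈ A, interNum A ≤ μ a := by
  classical
  obtain ⟨μ, hμ, h⟩ := isCompact_setOf_isFAMeasure.inter_iInter_nonempty
    (fun a : A => {μ : α → ℝ | interNum A ≤ μ a})
    (fun a => isClosed_le continuous_const (continuous_apply (a : α))) (fun F => by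
      obtain ⟨μ, hμ, h⟩ := exists_isFAMeasure_interNum_le_of_finset hA
        (F := F.image ((↑) : A → α)) (by simp +contextual)
      refine ⟨μ, hμ, ?_⟩
      simp only [Set.mem_iInter]
      exact fun a ha => h a (Finset.mem_image_of_mem _ ha))
  exact ⟨μ, hμ, fun a ha => Set.mem_iInter.1 h ⟨a, ha⟩⟩

lemma exists_pairwiseDisjoint_refinement (s : Finset α) :
    ∃ t : Finset α, (↑t : Set α).PairwiseDisjoint id ∧ t.sup id = s.sup id ∧
      ∀ x ∈ t, ∃ y ∈ s, x ≤ y := by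
  classical
  induction s using Finset.induction_on with
  | empty => exact ⟨∅, by simp, rfl, by simp⟩
  | insert a s _ ih =>
    obtain ⟨t, hd, hs, hr⟩ := ih
    refine ⟨insert (a \ t.sup id) t, ?_, ?_, ?_⟩
    · rw [Finset.coe_insert]
      refine hd.insert fun b hb _ => ?_
      exact disjoint_sdiff_self_left.mono_right (Finset.le_sup (f := id) hb)
    · rw [Finset.sup_insert, Finset.sup_insert, ← hs]
      simp
    · intro x hx
      rcases Finset.mem_insert.1 hx with rfl | hx
      · exact ⟨a, Finset.mem_insert_self _ _, sdiff_le⟩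
      · obtain ⟨y, hy, hxy⟩ := hr x hx
        exact ⟨y, Finset.mem_insert_of_mem hy, hxy⟩

/-- A measure that is not nonatomic dominates a positive multiple of a two-valued measure. -/
lemma exists_isPrime_le_of_not_nonatomic {μ : α → ℝ} (hμ : IsFAMeasure μ) (h : ¬ Nonatomic μ) :
    ∃ ε : ℝ, 0 < ε ∧ ∃ I : Order.Ideal α, I.IsPrime ∧ ∀ a ∉ I, ε ≤ μ a := by
  classical
  unfold Nonatomic at h
  push Not at h
  obtain ⟨ε, hε, hpart⟩ := h
  let J : Order.Ideal α :=
    { carrier := {a | ∃ s : Finset α, a ≤ s.sup id ∧ ∀ x ∈ s, μ x < ε}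
      lower' := fun a b hba ⟨s, hs, hlt⟩ => ⟨s, hba.trans hs, hlt⟩
      nonempty' := ⟨⊥, ∅, by simp, by simp⟩
      directed' := by
        rintro a ⟨s, hs, hsε⟩ b ⟨t, ht, htε⟩
        refine ⟨a ⊔ b, ⟨s ∪ t, ?_, ?_⟩, le_sup_left, le_sup_right⟩
        · rw [Finset.sup_union]
          exact sup_le_sup hs ht
        · intro x hx
          rcases Finset.mem_union.1 hx with hx | hx
          exacts [hsε x hx, htε x hx] }
  have hJ : ⊤ ∉ J := by
    rintro ⟨s, hs, hlt⟩
    obtain ⟨t, hd, hsup, hr⟩ := exists_pairwiseDisjoint_refinement s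
    obtain ⟨x, hx, hεx⟩ := hpart t hd (by rw [hsup]; exact top_le_iff.1 hs)
    obtain ⟨y, hy, hxy⟩ := hr x hx
    linarith [hμ.mono hxy, hlt y hy]
  obtain ⟨I, hI, hJI⟩ := exists_isPrime_ge hJ
  refine ⟨ε, hε, I, hI, fun a ha => ?_⟩
  by_contra! hlt
  exact ha (hJI ⟨{a}, by simp, by simpa using hlt⟩)

lemma IsFAMeasure.sub_diracOf {μ : α → ℝ} (hμ : IsFAMeasure μ) {I : Order.Ideal α}
    (hI : I.IsPrime) {ε : ℝ} (h : ∀ a ∉ I, ε ≤ μ a) :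
    IsFAMeasure fun a => μ a - ε * diracOf I a := by
  have hδ := isFAMeasure_diracOf hI
  refine ⟨by simp [hμ.1, hδ.1], fun a => ?_, fun a b hab => ?_⟩
  · by_cases ha : a ∈ I
    · simpa [diracOf, ha] using hμ.2.1 a
    · simpa [diracOf, ha] using h a ha
  · simp only [hμ.2.2 a b hab, hδ.2.2 a b hab]
    ring

lemma IsFAMeasure.add_le {μ : α → ℝ} (hμ : IsFAMeasure μ) {a b c : α} (hbc : b ⊓ c = ⊥)
    (hb : b ≤ a) (hc : c ≤ a) : μ b + μ c ≤ μ a := by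
  rw [← hμ.2.2 b c hbc]
  exact hμ.mono (sup_le hb hc)

/-- Removing a point mass preserves the lower bounds `2⁻ⁿ` on a splitting sequence. -/
lemma pow_le_sub_diracOf {B : ℕ → Set α}
    (hsplit : ∀ n : ℕ, ∀ a ∈ B n, ∃ b c : α, b ∈ B (n + 1) ∧ c ∈ B (n + 1) ∧
      b ⊓ c = ⊥ ∧ b ≤ a ∧ c ≤ a)
    {μ : α → ℝ} (hμ : IsFAMeasure μ) (hB : ∀ n, ∀ a ∈ B n, ((1 : ℝ) / 2) ^ n ≤ μ a)
    {I : Order.Ideal α} (hI : I.IsPrime) {ε : ℝ} (h : ∀ a ∉ I, ε ≤ μ a)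
    {n : ℕ} {a : α} (ha : a ∈ B n) :
    ((1 : ℝ) / 2) ^ n ≤ μ a - ε * diracOf I a := by
  have hν := hμ.sub_diracOf hI h
  have hδ := isFAMeasure_diracOf hI
  have key : ∀ j n : ℕ, ∀ a ∈ B n,
      ((1 : ℝ) / 2) ^ n * (1 - diracOf I a * (1 / 2) ^ j) ≤ μ a - ε * diracOf I a := by
    intro j
    induction j with
    | zero =>
      intro n a ha
      by_cases haI : a ∈ I
      · simpa [diracOf, haI] using hB n a ha
      · simpa [diracOf, haI] using h a haI
    | succ j ih =>
      intro n a ha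
      obtain ⟨b, c, hb, hc, hbc, hba, hca⟩ := hsplit n a ha
      have h1 := ih _ b hb
      have h2 := ih _ c hc
      have h3 := hν.add_le hbc hba hca
      have h4 : (diracOf I b + diracOf I c) * (((1 : ℝ) / 2) ^ n * (1 / 2) ^ j) ≤
          diracOf I a * ((1 / 2) ^ n * (1 / 2) ^ j) :=
        mul_le_mul_of_nonneg_right (hδ.add_le hbc hba hca) (by positivity)
      simp only [pow_succ] at h1 h2 ⊢
      linarith
  have hlim : Filter.Tendsto
      (fun j : ℕ => ((1 : ℝ) / 2) ^ n * (1 - diracOf I a * (1 / 2) ^ j)) Filter.atTop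
      (nhds (((1 : ℝ) / 2) ^ n * (1 - diracOf I a * 0))) :=
    (((tendsto_pow_atTop_nhds_zero_of_lt_one (by norm_num) (by norm_num)).const_mul _).const_sub
      _).const_mul _
  have := le_of_tendsto' hlim fun j => key j n a ha
  simpa using this

/-- On a splitting sequence, Kelley's theorem can be satisfied for all levels simultaneously. -/
lemma exists_isFAMeasure_forall_pow_le [Nontrivial α] {B : ℕ → Set α}
    (hint : ∀ n : ℕ, ((1 : ℝ) / 2) ^ n ≤ interNum (B n))
    (hsplit : ∀ n : ℕ, ∀ a ∈ B n, ∃ b c : α, b ∈ B (n + 1) ∧ c ∈ B (n + 1) ∧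
      b ⊓ c = ⊥ ∧ b ≤ a ∧ c ≤ a) :
    ∃ μ : α → ℝ, (IsFAMeasure μ ∧ μ ⊤ ≤ 1) ∧ ∀ n, ∀ a ∈ B n, ((1 : ℝ) / 2) ^ n ≤ μ a := by
  let C : ℕ → Set (α → ℝ) := fun n =>
    {μ | IsFAMeasure μ ∧ μ ⊤ ≤ 1} ∩ {μ | ∀ a ∈ B n, ((1 : ℝ) / 2) ^ n ≤ μ a}
  have hcl : ∀ n, IsClosed {μ : α → ℝ | ∀ a ∈ B n, ((1 : ℝ) / 2) ^ n ≤ μ a} := by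
    intro n
    simp only [Set.ofPred_forall]
    exact isClosed_iInter fun a => isClosed_iInter fun _ =>
      isClosed_le continuous_const (continuous_apply a)
  have hC : (⋂ n, C n).Nonempty := by
    refine IsCompact.nonempty_iInter_of_sequence_nonempty_isCompact_isClosed C ?_ ?_
      (isCompact_setOf_isFAMeasure.inter_right (hcl 0))
      fun n => isCompact_setOf_isFAMeasure.isClosed.inter (hcl n)
    · rintro n μ ⟨hμ, hB⟩
      refine ⟨hμ, fun a ha => ?_⟩
      obtain ⟨b, c, hb, hc, hbc, hba, hca⟩ := hsplit n a ha
      have h1 := hB b hb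
      have h2 := hB c hc
      have h3 := hμ.1.add_le hbc hba hca
      rw [pow_succ] at h1 h2
      linarith
    · intro n
      obtain ⟨μ, hμ, h⟩ := exists_isFAMeasure_interNum_le
        (A := B n) (le_trans (by positivity) (hint n))
      exact ⟨μ, hμ, fun a ha => (hint n).trans (h a ha)⟩
  obtain ⟨μ, hμ⟩ := hC
  rw [Set.mem_iInter] at hμ
  exact ⟨μ, (hμ 0).1, fun n => (hμ n).2⟩

end FiniteAdditivity

theorem stmt2 {α : Type*} [BooleanAlgebra α] (B : ℕ → Set α)
    (hnz : ∀ n : ℕ, ∀ a ∈ B n, a ≠ (⊥ : α))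
    (hcover : ∀ a : α, a ≠ ⊥ → ∃ n : ℕ, a ∈ B n)
    (hmono : ∀ n : ℕ, B n ⊆ B (n + 1))
    (hint : ∀ n : ℕ, ((1 : ℝ) / 2) ^ n ≤ interNum (B n))
    (hsplit : ∀ n : ℕ, ∀ a ∈ B n, ∃ b c : α, b ∈ B (n + 1) ∧ c ∈ B (n + 1) ∧
      b ⊓ c = ⊥ ∧ b ≤ a ∧ c ≤ a) :
    ∃ μ : α → ℝ, IsFAMeasure μ ∧ StrictlyPositive μ ∧ Nonatomic μ := by
  rcases subsingleton_or_nontrivial α with hα | hα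
  · refine ⟨fun _ => 0, ⟨rfl, fun _ => le_rfl, fun _ _ _ => by simp⟩,
      fun a ha => absurd (Subsingleton.elim a ⊥) ha,
      fun ε _ => ⟨∅, by simp, Subsingleton.elim _ _, by simp⟩⟩
  have hcl : IsClosed {μ : α → ℝ | ∀ n, ∀ a ∈ B n, ((1 : ℝ) / 2) ^ n ≤ μ a} := by
    simp only [Set.ofPred_forall]
    exact isClosed_iInter fun n => isClosed_iInter fun a => isClosed_iInter fun _ =>
      isClosed_le continuous_const (continuous_apply a)
  -- Among the measures with these lower bounds, one of least total mass is nonatomic.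
  obtain ⟨μ, ⟨⟨hμ, hμ1⟩, hB⟩, hmin⟩ :=
    (isCompact_setOf_isFAMeasure.inter_right hcl).exists_isMinOn
      (exists_isFAMeasure_forall_pow_le hint hsplit)
      (continuous_apply (⊤ : α)).continuousOn
  refine ⟨μ, hμ, fun a ha => ?_, ?_⟩
  · obtain ⟨n, hn⟩ := hcover a ha
    exact lt_of_lt_of_le (by positivity) (hB n a hn)
  · by_contra hna
    obtain ⟨ε, hε, I, hI, hle⟩ := exists_isPrime_le_of_not_nonatomic hμ hna
    have htop : diracOf I (⊤ : α) = 1 := by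
      have : (⊤ : α) ∉ I := hI.toIsProper.top_notMem
      simp [diracOf, this]
    have h := hmin (a := fun a => μ a - ε * diracOf I a)
      ⟨⟨hμ.sub_diracOf hI hle, by simp only [htop]; linarith⟩,
        fun n a ha => pow_le_sub_diracOf hsplit hμ hB hI hle ha⟩
    simp only [Set.mem_ofPred_eq, htop] at h
    linarith
end

section
/- (Kelley) A Boolean algebra B carries a strictly positive finitely additive measure if and only if B \ {0} can be written as a countable union of families each having positive intersection number. -/
open scoped symmDiff

open Set

namespace IsFAMeasure

variable {α : Type*} [BooleanAlgebra α] {μ : α → ℝ}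

theorem apply_inf_add_apply_sdiff (hμ : IsFAMeasure μ) (a b : α) :
    μ (a ⊓ b) + μ (a \ b) = μ a := by
  rw [← hμ.2.2 _ _ (inf_inf_sdiff a b), sup_inf_sdiff]

theorem mono_s4 (hμ : IsFAMeasure μ) {a b : α} (h : a ≤ b) : μ a ≤ μ b := by
  have h₁ := hμ.apply_inf_add_apply_sdiff b a
  rw [inf_eq_right.2 h] at h₁
  linarith [hμ.2.1 (b \ a)]

/-- Some subfamily of `f` has nonzero meet inside `a` and at least the average size of `f` on `a`
with respect to `μ`. -/
theorem exists_subset_sum_le (hμ : IsFAMeasure μ) {ι : Type*}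
    (f : ι → α) (t : Finset ι) (a : α) (ha : a ≠ ⊥) :
    ∃ s ⊆ t, a ⊓ s.inf f ≠ ⊥ ∧ ∑ i ∈ t, μ (a ⊓ f i) ≤ s.card * μ a := by
  classical
  induction t using Finset.induction_on generalizing a with
  | empty => exact ⟨∅, subset_rfl, by simpa using ha, by simp⟩
  | insert j t hj ih =>
    have split : ∑ i ∈ t, μ (a ⊓ f i) =
        ∑ i ∈ t, μ (a ⊓ f j ⊓ f i) + ∑ i ∈ t, μ (a \ f j ⊓ f i) := by
      rw [← Finset.sum_add_distrib]
      refine Finset.sum_congr rfl fun i _ => ?_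
      rw [← hμ.apply_inf_add_apply_sdiff (a ⊓ f i) (f j), inf_right_comm, _root_.sdiff_eq, _root_.sdiff_eq,
        inf_right_comm a (f i) (f j)ᶜ]
    have hμa := hμ.apply_inf_add_apply_sdiff a (f j)
    rw [Finset.sum_insert hj, split]
    have inner : a ⊓ f j ≠ ⊥ → ∃ s ⊆ insert j t, a ⊓ s.inf f ≠ ⊥ ∧
        μ (a ⊓ f j) + ∑ i ∈ t, μ (a ⊓ f j ⊓ f i) ≤ s.card * μ (a ⊓ f j) := by
      intro h
      obtain ⟨s, hst, hs, hle⟩ := ih _ h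
      refine ⟨insert j s, Finset.insert_subset_insert _ hst, ?_, ?_⟩
      · rwa [Finset.inf_insert, ← inf_assoc]
      · rw [Finset.card_insert_of_notMem fun h => hj (hst h)]
        push_cast
        linarith
    have outer : a \ f j ≠ ⊥ → ∃ s ⊆ insert j t, a ⊓ s.inf f ≠ ⊥ ∧
        ∑ i ∈ t, μ (a \ f j ⊓ f i) ≤ s.card * μ (a \ f j) := by
      intro h
      obtain ⟨s, hst, hs, hle⟩ := ih _ h
      exact ⟨s, hst.trans (Finset.subset_insert _ _),
        ne_bot_of_le_ne_bot hs (inf_le_inf_right _ sdiff_le), hle⟩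
    by_cases h₁ : a ⊓ f j = ⊥
    · have h₂ : a \ f j ≠ ⊥ := fun h₂ => ha (by rw [← sup_inf_sdiff a (f j), h₁, h₂, sup_bot_eq])
      obtain ⟨s, hst, hs, hle⟩ := outer h₂
      refine ⟨s, hst, hs, ?_⟩
      rw [h₁, hμ.1] at hμa ⊢
      simp only [bot_inf_eq, hμ.1, Finset.sum_const_zero]
      rw [← hμa]
      linarith
    by_cases h₂ : a \ f j = ⊥
    · obtain ⟨s, hst, hs, hle⟩ := inner h₁
      refine ⟨s, hst, hs, ?_⟩
      rw [h₂, hμ.1] at hμa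
      simp only [h₂, bot_inf_eq, hμ.1, Finset.sum_const_zero]
      rw [← hμa]
      linarith
    obtain ⟨s₁, hst₁, hs₁, hle₁⟩ := inner h₁
    obtain ⟨s₂, hst₂, hs₂, hle₂⟩ := outer h₂
    have p₁ := hμ.2.1 (a ⊓ f j)
    have p₂ := hμ.2.1 (a \ f j)
    rcases le_total s₁.card s₂.card with h | h
    · refine ⟨s₂, hst₂, hs₂, ?_⟩
      have := mul_le_mul_of_nonneg_right (Nat.cast_le (α := ℝ).2 h) p₁
      rw [← hμa]
      linarith
    · refine ⟨s₁, hst₁, hs₁, ?_⟩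
      have := mul_le_mul_of_nonneg_right (Nat.cast_le (α := ℝ).2 h) p₂
      rw [← hμa]
      linarith

theorem interNum_pos (hμ : IsFAMeasure μ) {ε : ℝ} (hε : 0 < ε) :
    0 < interNum {a | ε ≤ μ a} := by
  have hM : 0 < μ ⊤ + ε := by linarith [hμ.2.1 ⊤]
  refine (div_pos hε hM).trans_le (le_csSup ⟨1, fun r hr => hr.2.1⟩
    ⟨(div_pos hε hM).le, (div_le_one hM).2 (by linarith [hμ.2.1 ⊤]), fun m f hf => ?_⟩)
  rcases m.eq_zero_or_pos with rfl | hm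
  · exact ⟨∅, by simp, by simp⟩
  have htop : (⊤ : α) ≠ ⊥ := fun h => by
    have h₁ : ε ≤ μ (f ⟨0, hm⟩) := hf _
    have h₂ := hμ.mono_s4 (le_top : f ⟨0, hm⟩ ≤ ⊤)
    rw [h, hμ.1] at h₂
    linarith
  obtain ⟨s, -, hs, hle⟩ := hμ.exists_subset_sum_le f Finset.univ ⊤ htop
  rw [top_inf_eq] at hs
  refine ⟨s, ?_, fun _ => hs⟩
  have hsum : m * ε ≤ ∑ i, μ (⊤ ⊓ f i) := by
    simpa using Finset.card_nsmul_le_sum Finset.univ (fun i => μ (⊤ ⊓ f i)) ε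
      (fun i _ => by simpa using hf i)
  rw [div_mul_eq_mul_div, div_le_iff₀ hM]
  have : 0 ≤ (s.card : ℝ) * ε := by positivity
  linarith

end IsFAMeasure

namespace IsFAProb

variable {α : Type*} [BooleanAlgebra α]

theorem le_one {μ : α → ℝ} (hμ : IsFAProb μ) (a : α) : μ a ≤ 1 :=
  hμ.2 ▸ hμ.1.mono_s4 le_top

theorem isCompact_setOf : IsCompact {μ : α → ℝ | IsFAProb μ} := by
  refine (isCompact_univ_pi fun _ : α => isCompact_Icc (a := (0 : ℝ)) (b := 1)).of_isClosed_subset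
    ?_ fun μ hμ a _ => ⟨hμ.1.2.1 a, hμ.le_one a⟩
  simp only [IsFAProb, IsFAMeasure, ofPred_and, ofPred_forall]
  refine IsClosed.inter (IsClosed.inter ?_ (IsClosed.inter ?_ ?_)) ?_
  · exact isClosed_eq (by fun_prop) (by fun_prop)
  · exact isClosed_iInter fun a => isClosed_le (by fun_prop) (by fun_prop)
  · exact isClosed_iInter fun a => isClosed_iInter fun b => isClosed_iInter fun _ =>
      isClosed_eq (by fun_prop) (by fun_prop)
  · exact isClosed_eq (by fun_prop) (by fun_prop)

theorem convex_setOf : Convex ℝ {μ : α → ℝ | IsFAProb μ} := by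
  rintro μ ⟨⟨h₀, h₁, h₂⟩, h₃⟩ ν ⟨⟨k₀, k₁, k₂⟩, k₃⟩ s t hs ht hst
  refine ⟨⟨by simp [h₀, k₀], fun a => ?_, fun a b hab => ?_⟩, by simpa [h₃, k₃] using hst⟩
  · exact add_nonneg (mul_nonneg hs (h₁ a)) (mul_nonneg ht (k₁ a))
  · simp only [Pi.add_apply, Pi.smul_apply, smul_eq_mul, h₂ a b hab, k₂ a b hab]
    ring

/-- Every nonzero element has full measure for some (two-valued) probability. -/
theorem exists_apply_eq_one {c : α} (hc : c ≠ ⊥) : ∃ μ : α → ℝ, IsFAProb μ ∧ μ c = 1 := by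
  classical
  obtain ⟨I, hI, -, hdisj⟩ := DistribLattice.prime_ideal_of_disjoint_filter_ideal
    (F := Order.PFilter.principal c) (I := Order.Ideal.principal ⊥) (by
      rw [Set.disjoint_left]
      intro x hx hx'
      have h₁ : c ≤ x := Order.PFilter.mem_principal.1 hx
      have h₂ : x = ⊥ := le_bot_iff.1 (Order.Ideal.mem_principal.1 hx')
      exact hc (le_bot_iff.1 (h₂ ▸ h₁)))
  have hcI : c ∉ I := fun h => Set.disjoint_left.1 hdisj (Order.PFilter.mem_principal.2 le_rfl) h
  have htop : ⊤ ∉ I := fun h => hcI (I.lower le_top h)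
  refine ⟨fun a => if a ∈ I then 0 else 1, ⟨⟨by simp, fun a => ?_, fun a b hab => ?_⟩, ?_⟩, ?_⟩
  · dsimp only
    split_ifs <;> norm_num
  · have hor : a ∈ I ∨ b ∈ I := hI.mem_or_mem (hab ▸ I.bot_mem)
    simp only [Order.Ideal.sup_mem_iff]
    by_cases h₁ : a ∈ I <;> by_cases h₂ : b ∈ I <;> simp_all
  · simp [htop]
  · simp [hcI]

end IsFAProb

section Kelley

variable {α : Type*} [BooleanAlgebra α]

/-- Nonnegative real weights that separate can be replaced by natural number multiplicities. -/
theorem exists_nat_weights {ι : Type*} [Fintype ι] {K : Set (ι → ℝ)}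
    (hK : ∀ x ∈ K, ∀ i, 0 ≤ x i) {w : ι → ℝ} (hw : ∀ i, 0 ≤ w i) {r u : ℝ} (hr : 0 ≤ r)
    (hu : ∀ x ∈ K, ∑ i, w i * x i ≤ u) (hur : u < r * ∑ i, w i) :
    ∃ n : ι → ℕ, ∀ x ∈ K, ∑ i, n i * x i < r * ∑ i, (n i : ℝ) := by
  obtain ⟨N, hN⟩ := exists_nat_gt (r * Fintype.card ι / (r * ∑ i, w i - u))
  rw [div_lt_iff₀ (sub_pos.2 hur)] at hN
  refine ⟨fun i => ⌊N * w i⌋₊, fun x hx => ?_⟩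
  calc ∑ i, (⌊N * w i⌋₊ : ℝ) * x i ≤ ∑ i, N * w i * x i :=
        Finset.sum_le_sum fun i _ => mul_le_mul_of_nonneg_right
          (Nat.floor_le (mul_nonneg N.cast_nonneg (hw i))) (hK x hx i)
    _ = N * ∑ i, w i * x i := by simp only [Finset.mul_sum, mul_assoc]
    _ ≤ N * u := mul_le_mul_of_nonneg_left (hu x hx) N.cast_nonneg
    _ < r * ∑ i, (N * w i - 1) := by
        rw [Finset.sum_sub_distrib, ← Finset.mul_sum]
        simp only [Finset.sum_const, Finset.card_univ, nsmul_eq_mul, mul_one]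
        linarith
    _ ≤ r * ∑ i, (⌊N * w i⌋₊ : ℝ) := mul_le_mul_of_nonneg_left
        (Finset.sum_le_sum fun i _ => (Nat.sub_one_lt_floor _).le) hr

/-- If a compact convex subset of the nonnegative orthant contains no point all of whose
coordinates are at least `r`, this is witnessed by natural number weights. -/
theorem exists_nat_weights_of_isCompact {ι : Type*} [Fintype ι] {K : Set (ι → ℝ)}
    (hcomp : IsCompact K) (hconv : Convex ℝ K) (hK : ∀ x ∈ K, ∀ i, 0 ≤ x i) {r : ℝ} (hr : 0 ≤ r)
    (hdisj : ∀ x ∈ K, ∃ i, x i < r) :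
    ∃ n : ι → ℕ, ∀ x ∈ K, ∑ i, n i * x i < r * ∑ i, (n i : ℝ) := by
  classical
  obtain ⟨l, u, v, hlu, huv, hlv⟩ := geometric_hahn_banach_compact_closed hconv hcomp
    (convex_Ici (𝕜 := ℝ) fun _ : ι => r) isClosed_Ici (by
      rw [Set.disjoint_left]
      intro x hx hx'
      obtain ⟨i, hi⟩ := hdisj x hx
      exact hi.not_ge (hx' i))
  have hl : ∀ x : ι → ℝ, l x = ∑ i, l (Pi.single i 1) * x i := fun x => by
    conv_lhs => rw [pi_eq_sum_univ' x, map_sum]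
    refine Finset.sum_congr rfl fun i _ => ?_
    rw [map_smul, smul_eq_mul, mul_comm]
  refine exists_nat_weights hK (w := fun i => l (Pi.single i 1)) (fun i => ?_) hr
    (fun x hx => (hl x ▸ hlu x hx).le) ?_
  · by_contra! hneg
    have hmem : ∀ t : ℝ, 0 ≤ t → v < l (fun _ => r) + t * l (Pi.single i 1) := fun t ht => by
      rw [← smul_eq_mul, ← map_smul, ← map_add]
      refine hlv _ (mem_Ici.2 <| le_add_of_nonneg_right (smul_nonneg ht ?_))
      exact Pi.single_nonneg.2 zero_le_one
    have h₀ := hmem 0 le_rfl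
    have h := hmem ((v - l fun _ => r) / l (Pi.single i 1))
      (div_nonneg_of_nonpos (by linarith) hneg.le)
    rw [div_mul_cancel₀ _ hneg.ne] at h
    linarith
  · have h := hlv (fun _ => r) self_mem_Ici
    rw [hl, ← Finset.sum_mul, mul_comm] at h
    exact huv.trans h

/-- Kelley's theorem for a single family: a proportion valid for all finite sequences
from `A` is a common lower bound for the values of some probability on `A`. -/
theorem exists_isFAProb_forall_le [Nontrivial α] {A : Set α} {r : ℝ} (hr : 0 < r)
    (hA : ∀ (m : ℕ) (f : Fin m → α), (∀ i, f i ∈ A) →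
      ∃ s : Finset (Fin m), r * (m : ℝ) ≤ (s.card : ℝ) ∧ (s.Nonempty → s.inf f ≠ ⊥)) :
    ∃ μ : α → ℝ, IsFAProb μ ∧ ∀ a ∈ A, r ≤ μ a := by
  obtain ⟨μ, hμ, hμA⟩ := IsFAProb.isCompact_setOf.inter_iInter_nonempty
    (fun a : A => {μ : α → ℝ | r ≤ μ a})
    (fun a => isClosed_le (by fun_prop) (by fun_prop)) (fun F => by
      by_contra hne
      let R : (α → ℝ) →ₗ[ℝ] (F → ℝ) := LinearMap.funLeft ℝ ℝ fun a : F => ((a : A) : α)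
      have hR : Continuous R := continuous_pi fun a => continuous_apply _
      obtain ⟨n, hn⟩ := exists_nat_weights_of_isCompact (r := r)
        (IsFAProb.isCompact_setOf.image hR) (IsFAProb.convex_setOf.linear_image R)
        (by rintro _ ⟨μ, hμ, rfl⟩ i; exact hμ.1.2.1 _) hr.le (by
          rintro _ ⟨μ, hμ, rfl⟩
          by_contra! h
          exact hne ⟨μ, hμ, mem_iInter₂.2 fun a haF => h ⟨a, haF⟩⟩)
      have hn' : ∀ μ : α → ℝ, IsFAProb μ → ∑ i, n i * μ (i : A) < r * ∑ i, (n i : ℝ) :=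
        fun μ hμ => hn _ ⟨μ, hμ, rfl⟩
      let e := (Fintype.equivFin (Σ a : F, Fin (n a))).symm
      let f : Fin (Fintype.card (Σ a : F, Fin (n a))) → α := fun i => ((e i).1 : A)
      have hsum : ∀ μ : α → ℝ, ∑ i, μ (f i) = ∑ i, n i * μ (i : A) := fun μ => by
        rw [e.sum_comp fun p => μ (p.1 : A), Fintype.sum_sigma]
        simp
      obtain ⟨s, hs, hsne⟩ := hA _ f fun i => ((e i).1 : A).2
      simp only [Fintype.card_sigma, Fintype.card_fin, Nat.cast_sum] at hs
      have key : ∃ μ : α → ℝ, IsFAProb μ ∧ ∀ i ∈ s, μ (f i) = 1 := by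
        rcases s.eq_empty_or_nonempty with rfl | h
        · obtain ⟨μ, hμ, -⟩ := IsFAProb.exists_apply_eq_one (top_ne_bot : (⊤ : α) ≠ ⊥)
          exact ⟨μ, hμ, by simp⟩
        · obtain ⟨μ, hμ, h₁⟩ := IsFAProb.exists_apply_eq_one (hsne h)
          exact ⟨μ, hμ, fun i hi =>
            (hμ.le_one _).antisymm (h₁ ▸ hμ.1.mono_s4 (Finset.inf_le hi))⟩
      obtain ⟨μ, hμ, h₁⟩ := key
      have h₂ := hn' μ hμ
      have h₃ : (s.card : ℝ) ≤ ∑ i, μ (f i) := by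
        calc (s.card : ℝ) = ∑ i ∈ s, μ (f i) := by simp [Finset.sum_congr rfl h₁]
          _ ≤ _ := Finset.sum_le_sum_of_subset_of_nonneg (Finset.subset_univ _)
            fun i _ _ => hμ.1.2.1 _
      rw [hsum] at h₃
      linarith)
  exact ⟨μ, hμ, fun a ha => mem_iInter.1 hμA ⟨a, ha⟩⟩

theorem exists_isFAProb_of_interNum_pos [Nontrivial α] {A : Set α} (hA : 0 < interNum A) :
    ∃ μ : α → ℝ, IsFAProb μ ∧ ∀ a ∈ A, 0 < μ a := by
  have hne : {r : ℝ | 0 ≤ r ∧ r ≤ 1 ∧ ∀ (m : ℕ) (f : Fin m → α), (∀ i, f i ∈ A) →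
      ∃ s : Finset (Fin m), r * (m : ℝ) ≤ (s.card : ℝ) ∧ (s.Nonempty → s.inf f ≠ ⊥)}.Nonempty :=
    ⟨0, le_rfl, zero_le_one, fun m f _ => ⟨∅, by simp, by simp⟩⟩
  obtain ⟨r, ⟨-, -, hr⟩, hr₀⟩ := exists_lt_of_lt_csSup hne hA
  obtain ⟨μ, hμ, h⟩ := exists_isFAProb_forall_le hr₀ hr
  exact ⟨μ, hμ, fun a ha => hr₀.trans_le (h a ha)⟩

/-- Countably many probabilities are dominated by a single measure. -/
theorem exists_isFAMeasure_pos_of_seq {μ : ℕ → α → ℝ} (hμ : ∀ n, IsFAProb (μ n)) :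
    ∃ ν : α → ℝ, IsFAMeasure ν ∧ ∀ n a, 0 < μ n a → 0 < ν a := by
  have hnonneg : ∀ a n, 0 ≤ (1 / 2 : ℝ) ^ n * μ n a := fun a n =>
    mul_nonneg (by positivity) ((hμ n).1.2.1 a)
  have hsum : ∀ a, Summable fun n => (1 / 2 : ℝ) ^ n * μ n a := fun a =>
    Summable.of_nonneg_of_le (hnonneg a)
      (fun n => mul_le_of_le_one_right (by positivity) ((hμ n).le_one a)) summable_geometric_two
  refine ⟨fun a => ∑' n, (1 / 2 : ℝ) ^ n * μ n a, ⟨?_, fun a => tsum_nonneg (hnonneg a), ?_⟩, ?_⟩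
  · simp [(hμ _).1.1]
  · intro a b hab
    dsimp only
    rw [← (hsum a).tsum_add (hsum b)]
    exact tsum_congr fun n => by rw [(hμ n).1.2.2 a b hab, mul_add]
  · exact fun n a h => (hsum a).tsum_pos (hnonneg a) n (mul_pos (by positivity) h)

end Kelley

theorem stmt4 {α : Type*} [BooleanAlgebra α] :
    (∃ μ : α → ℝ, IsFAMeasure μ ∧ StrictlyPositive μ) ↔
    ∃ B : ℕ → Set α,
      (∀ n : ℕ, ∀ a ∈ B n, a ≠ (⊥ : α)) ∧
      (∀ a : α, a ≠ ⊥ → ∃ n : ℕ, a ∈ B n) ∧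
      (∀ n : ℕ, 0 < interNum (B n)) := by
  constructor
  · rintro ⟨μ, hμ, hpos⟩
    have hε : ∀ n : ℕ, 0 < 1 / ((n : ℝ) + 1) := fun n => Nat.one_div_pos_of_nat
    refine ⟨fun n => {a | 1 / ((n : ℝ) + 1) ≤ μ a}, ?_, fun a ha => ?_,
      fun n => hμ.interNum_pos (hε n)⟩
    · rintro n a ha rfl
      exact ((hε n).trans_le ha).ne' hμ.1
    · obtain ⟨n, hn⟩ := exists_nat_one_div_lt (hpos a ha)
      exact ⟨n, hn.le⟩
  · rintro ⟨B, -, hcover, hB⟩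
    cases subsingleton_or_nontrivial α with
    | inl h =>
      exact ⟨fun _ => 0, ⟨rfl, fun _ => le_rfl, fun _ _ _ => by simp⟩,
        fun a ha => (ha (Subsingleton.elim _ _)).elim⟩
    | inr h =>
      choose μ hμ hpos using fun n => exists_isFAProb_of_interNum_pos (hB n)
      obtain ⟨ν, hν, hνpos⟩ := exists_isFAMeasure_pos_of_seq hμ
      refine ⟨ν, hν, fun a ha => ?_⟩
      obtain ⟨n, hn⟩ := hcover a ha
      exact hνpos n a (hpos n a hn)
end
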